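/- Every stabilization R₁ ↦ R₂ of rectangular diagrams of links can be decomposed into a chain of three elementary moves from R₁ to R₂ in which the first move is a local stabilization and the other two moves are exchange moves. -/

import Mathlib

open scoped Real

noncomputable section

namespace RectDiag

instance : DecidableEq Real.Angle := Classical.decEq _

/-- The torus `T² = S¹ × S¹` with angular coordinates `(θ, φ)`. -/
abbrev Torus := Real.Angle × Real.Angle

/-- The length of the arc running from `x` to `y` in the positive direction. -/
def arcLen (x y : Real.Angle) : ℝ :=
  if (y - x).toReal < 0 then (y - x).toReal + 2 * Real.pi else (y - x).toReal

/-- The closed arc `[x;y]` running from `x` to `y` in the positive direction. -/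
def Arc (x y : Real.Angle) : Set Real.Angle :=
  {z | ∃ t : ℝ, 0 ≤ t ∧ t ≤ arcLen x y ∧ z = x + (t : Real.Angle)}

/-- The open arc `(x;y)`, the interior of `[x;y]`. -/
def ArcInt (x y : Real.Angle) : Set Real.Angle :=
  {z | ∃ t : ℝ, 0 < t ∧ t < arcLen x y ∧ z = x + (t : Real.Angle)}

/-- Every meridian `{θ}×S¹` contains no or exactly two points of `V`, of opposite signs. -/
def MeridianOK (V : Finset Torus) (sgn : Torus → Bool) : Prop :=
  ∀ θ : Real.Angle, (∀ v ∈ V, v.1 ≠ θ) ∨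
    ∃ u w, u ∈ V ∧ w ∈ V ∧ u ≠ w ∧ u.1 = θ ∧ w.1 = θ ∧ sgn u ≠ sgn w ∧
      ∀ x ∈ V, x.1 = θ → x = u ∨ x = w

/-- Every longitude `S¹×{φ}` contains no or exactly two points of `V`, of opposite signs. -/
def LongitudeOK (V : Finset Torus) (sgn : Torus → Bool) : Prop :=
  ∀ φ : Real.Angle, (∀ v ∈ V, v.2 ≠ φ) ∨
    ∃ u w, u ∈ V ∧ w ∈ V ∧ u ≠ w ∧ u.2 = φ ∧ w.2 = φ ∧ sgn u ≠ sgn w ∧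
      ∀ x ∈ V, x.2 = φ → x = u ∨ x = w

/-- `V` with sign assignment `sgn` satisfies the conditions of a rectangular diagram. -/
def IsDiagSet (V : Finset Torus) (sgn : Torus → Bool) : Prop :=
  MeridianOK V sgn ∧ LongitudeOK V sgn

/-- `S` is a connected component of `V`: a minimal nonempty subset of `V` that is itself a
rectangular diagram of a link (with the inherited signs). -/
def IsComponent (V : Finset Torus) (sgn : Torus → Bool) (S : Finset Torus) : Prop :=
  S ⊆ V ∧ S.Nonempty ∧ IsDiagSet S sgn ∧
    ∀ S' ⊆ S, S'.Nonempty → IsDiagSet S' sgn → S' = S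

/-- An oriented rectangular diagram of a link with numbered connected components:
a finite subset of the torus with a sign assignment satisfying the meridian/longitude
conditions, together with a numbering of the vertices which is constant exactly on
connected components. -/
structure RectDiagram where
  verts : Finset Torus
  sgn : Torus → Bool
  comp : Torus → ℕ
  diag : IsDiagSet verts sgn
  comp_eq_iff : ∀ u ∈ verts, ∀ v ∈ verts,
    (comp u = comp v ↔ ∃ S, IsComponent verts sgn S ∧ u ∈ S ∧ v ∈ S)

/-- `{u,v}` is a (vertical or horizontal) edge of the diagram `R`. -/
def IsEdge (R : RectDiagram) (u v : Torus) : Prop :=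
  u ∈ R.verts ∧ v ∈ R.verts ∧ u ≠ v ∧ (u.1 = v.1 ∨ u.2 = v.2)

/-- The four corner points `{θ₁,θ₂}×{φ₁,φ₂}`. -/
def corners (t1 t2 p1 p2 : Real.Angle) : Finset Torus :=
  {(t1, p1), (t1, p2), (t2, p1), (t2, p2)}

/-- The rectangle `[θ₁;θ₂]×[φ₁;φ₂] ⊆ T²`. -/
def RectSet (t1 t2 p1 p2 : Real.Angle) : Set Torus :=
  {p | p.1 ∈ Arc t1 t2 ∧ p.2 ∈ Arc p1 p2}

/-- `R₁ ↦ R₂` is an elementary move associated with the rectangle `[θ₁;θ₂]×[φ₁;φ₂]`. -/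
def IsElemMoveWith (R₁ R₂ : RectDiagram) (t1 t2 p1 p2 : Real.Angle) : Prop :=
  t1 ≠ t2 ∧ p1 ≠ p2 ∧
  symmDiff R₁.verts R₂.verts = corners t1 t2 p1 p2 ∧
  (∃ u v : Torus, u ∈ symmDiff R₁.verts R₂.verts ∧ v ∈ symmDiff R₁.verts R₂.verts ∧
      (IsEdge R₁ u v ∨ IsEdge R₂ u v)) ∧
  ¬ R₁.verts ⊆ R₂.verts ∧ ¬ R₂.verts ⊆ R₁.verts ∧
  RectSet t1 t2 p1 p2 ∩ (↑R₁.verts ∪ ↑R₂.verts) = ↑(corners t1 t2 p1 p2) ∧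
  ∀ v ∈ R₁.verts ∩ R₂.verts, R₁.sgn v = R₂.sgn v ∧ R₁.comp v = R₂.comp v

/-- `R₁ ↦ R₂` is an elementary move. -/
def IsElemMove (R₁ R₂ : RectDiagram) : Prop :=
  ∃ t1 t2 p1 p2 : Real.Angle, IsElemMoveWith R₁ R₂ t1 t2 p1 p2

/-- An exchange move. -/
def IsExchange (R₁ R₂ : RectDiagram) : Prop :=
  IsElemMove R₁ R₂ ∧ R₂.verts.card = R₁.verts.card

/-- A stabilization. -/
def IsStab (R₁ R₂ : RectDiagram) : Prop :=
  IsElemMove R₁ R₂ ∧ R₂.verts.card = R₁.verts.card + 2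

/-- A destabilization. -/
def IsDestab (R₁ R₂ : RectDiagram) : Prop :=
  IsElemMove R₁ R₂ ∧ R₁.verts.card = R₂.verts.card + 2

/-- A stabilization associated with a given rectangle. -/
def IsStabWith (R₁ R₂ : RectDiagram) (t1 t2 p1 p2 : Real.Angle) : Prop :=
  IsElemMoveWith R₁ R₂ t1 t2 p1 p2 ∧ R₂.verts.card = R₁.verts.card + 2

/-- The type I corner condition: `R₁ ∩ V ⊆ {(θ₁,φ₁),(θ₂,φ₂)}`. -/
def TypeICornerCond (R₁ : RectDiagram) (t1 t2 p1 p2 : Real.Angle) : Prop :=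
  ∀ v ∈ R₁.verts, v ∈ corners t1 t2 p1 p2 → v = (t1, p1) ∨ v = (t2, p2)

/-- The type II corner condition: `R₁ ∩ V ⊆ {(θ₁,φ₂),(θ₂,φ₁)}`. -/
def TypeIICornerCond (R₁ : RectDiagram) (t1 t2 p1 p2 : Real.Angle) : Prop :=
  ∀ v ∈ R₁.verts, v ∈ corners t1 t2 p1 p2 → v = (t1, p2) ∨ v = (t2, p1)

/-- `R₁ ↦ R₂` is a type I stabilization. -/
def IsTypeIStab (R₁ R₂ : RectDiagram) : Prop :=
  ∃ t1 t2 p1 p2, IsStabWith R₁ R₂ t1 t2 p1 p2 ∧ TypeICornerCond R₁ t1 t2 p1 p2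

/-- `R₁ ↦ R₂` is a type II stabilization. -/
def IsTypeIIStab (R₁ R₂ : RectDiagram) : Prop :=
  ∃ t1 t2 p1 p2, IsStabWith R₁ R₂ t1 t2 p1 p2 ∧ TypeIICornerCond R₁ t1 t2 p1 p2

/-- `R₁ ↦ R₂` is a type I destabilization. -/
def IsTypeIDestab (R₁ R₂ : RectDiagram) : Prop := IsTypeIStab R₂ R₁

/-- `R₁ ↦ R₂` is a type II destabilization. -/
def IsTypeIIDestab (R₁ R₂ : RectDiagram) : Prop := IsTypeIIStab R₂ R₁

/-- The four oriented types `→I`, `←I`, `→II`, `←II` of (de)stabilizations. -/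
inductive OType
  | posI
  | negI
  | posII
  | negII
deriving DecidableEq

/-- Whether an oriented type is of (unoriented) type I. -/
def OType.isI : OType → Bool
  | .posI => true
  | .negI => true
  | _ => false

/-- `R₁ ↦ R₂` is a stabilization of the given oriented type. -/
def IsStabOfOType (R₁ R₂ : RectDiagram) (t : OType) : Prop :=
  ∃ t1 t2 p1 p2, IsStabWith R₁ R₂ t1 t2 p1 p2 ∧
    ∃ p0, (p0 = p1 ∨ p0 = p2) ∧ (t1, p0) ∈ R₂.verts ∧ (t2, p0) ∈ R₂.verts ∧
      (match t with
        | .posI => TypeICornerCond R₁ t1 t2 p1 p2 ∧ R₂.sgn (t2, p0) = true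
        | .negI => TypeICornerCond R₁ t1 t2 p1 p2 ∧ R₂.sgn (t2, p0) = false
        | .posII => TypeIICornerCond R₁ t1 t2 p1 p2 ∧ R₂.sgn (t2, p0) = true
        | .negII => TypeIICornerCond R₁ t1 t2 p1 p2 ∧ R₂.sgn (t2, p0) = false)

/-- `R₁ ↦ R₂` is a destabilization of the given oriented type. -/
def IsDestabOfOType (R₁ R₂ : RectDiagram) (t : OType) : Prop := IsStabOfOType R₂ R₁ t

/-- The move `R₁ ↦ R₂` is performed on (modifies) the connected component number `i`. -/
def ModifiesComp (R₁ R₂ : RectDiagram) (i : ℕ) : Prop :=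
  ∃ v ∈ R₁.verts, v ∉ R₂.verts ∧ R₁.comp v = i

/-- The kind of an elementary move: an exchange, a stabilization of oriented type `t`
on the component number `i`, or a destabilization of oriented type `t` on the component
number `i`. -/
inductive MoveKind
  | exchange
  | stab (t : OType) (i : ℕ)
  | destab (t : OType) (i : ℕ)
deriving DecidableEq

/-- The pair `(R₁, R₂)` is an elementary move realizing the given kind. -/
def KindOk (R₁ R₂ : RectDiagram) : MoveKind → Prop
  | .exchange => IsExchange R₁ R₂
  | .stab t i => IsStabOfOType R₁ R₂ t ∧ ModifiesComp R₁ R₂ i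
  | .destab t i => IsDestabOfOType R₁ R₂ t ∧ ModifiesComp R₁ R₂ i

/-- `LChain R s R'` : `s` is a chain of elementary moves from `R` to `R'`, each move
labeled by its kind. -/
def LChain : RectDiagram → List (MoveKind × RectDiagram) → RectDiagram → Prop
  | R, [], R' => R = R'
  | R, (k, S) :: rest, R' => KindOk R S k ∧ LChain S rest R'


/-- An elementary move associated with a rectangle is local if the open annuli
`(θ₁;θ₂)×S¹` and `S¹×(φ₁;φ₂)` are disjoint from both diagrams. -/
def IsLocalMoveWith (R₁ R₂ : RectDiagram) (t1 t2 p1 p2 : Real.Angle) : Prop :=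
  IsElemMoveWith R₁ R₂ t1 t2 p1 p2 ∧
  ∀ v : Torus, (v ∈ R₁.verts ∨ v ∈ R₂.verts) →
    v.1 ∉ ArcInt t1 t2 ∧ v.2 ∉ ArcInt p1 p2

/-- A local stabilization. -/
def IsLocalStab (R₁ R₂ : RectDiagram) : Prop :=
  ∃ t1 t2 p1 p2, IsLocalMoveWith R₁ R₂ t1 t2 p1 p2 ∧
    R₂.verts.card = R₁.verts.card + 2

/-! ### Arcs of the circle -/

lemma arcLen_nonneg (x y : Real.Angle) : 0 ≤ arcLen x y := by
  unfold arcLen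
  have := (y - x).neg_pi_lt_toReal
  split_ifs <;> linarith [Real.pi_pos]

lemma arcLen_lt_two_pi (x y : Real.Angle) : arcLen x y < 2 * π := by
  unfold arcLen
  have := (y - x).toReal_le_pi
  split_ifs <;> linarith [Real.pi_pos]

lemma add_arcLen (x y : Real.Angle) : x + (arcLen x y : Real.Angle) = y := by
  unfold arcLen
  split_ifs <;> simp

lemma arcLen_add {x : Real.Angle} {r : ℝ} (h0 : 0 ≤ r) (h1 : r < 2 * π) :
    arcLen x (x + (r : Real.Angle)) = r := by
  have h : ((arcLen x (x + (r : Real.Angle)) : ℝ) : Real.Angle) = (r : Real.Angle) :=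
    add_left_cancel (add_arcLen x (x + (r : Real.Angle)))
  rw [Real.Angle.angle_eq_iff_two_pi_dvd_sub] at h
  obtain ⟨k, hk⟩ := h
  have h2 := arcLen_nonneg x (x + (r : Real.Angle))
  have h3 := arcLen_lt_two_pi x (x + (r : Real.Angle))
  have hpi := Real.pi_pos
  have hk1 : (k : ℝ) < 1 := by nlinarith
  have hk2 : (-1 : ℝ) < k := by nlinarith
  have hk0 : k = 0 := by
    have h4 : k < 1 := by exact_mod_cast hk1
    have h5 : -1 < k := by exact_mod_cast hk2
    omega
  subst hk0
  simp at hk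
  linarith

lemma arcLen_self (x : Real.Angle) : arcLen x x = 0 := by
  simp [arcLen]

lemma arcLen_pos {x y : Real.Angle} (h : x ≠ y) : 0 < arcLen x y := by
  refine lt_of_le_of_ne (arcLen_nonneg x y) fun h0 => h ?_
  have := add_arcLen x y
  rw [← h0] at this
  simpa using this

lemma mem_Arc_iff {x y z : Real.Angle} : z ∈ Arc x y ↔ arcLen x z ≤ arcLen x y := by
  constructor
  · rintro ⟨t, h0, h1, rfl⟩
    rwa [arcLen_add h0 (h1.trans_lt (arcLen_lt_two_pi x y))]
  · intro h
    exact ⟨arcLen x z, arcLen_nonneg x z, h, (add_arcLen x z).symm⟩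

lemma mem_ArcInt_iff {x y z : Real.Angle} :
    z ∈ ArcInt x y ↔ 0 < arcLen x z ∧ arcLen x z < arcLen x y := by
  constructor
  · rintro ⟨t, h0, h1, rfl⟩
    rw [arcLen_add h0.le (h1.trans (arcLen_lt_two_pi x y))]
    exact ⟨h0, h1⟩
  · rintro ⟨h0, h1⟩
    exact ⟨arcLen x z, h0, h1, (add_arcLen x z).symm⟩

lemma left_mem_Arc (x y : Real.Angle) : x ∈ Arc x y :=
  mem_Arc_iff.2 (by rw [arcLen_self]; exact arcLen_nonneg x y)

lemma right_mem_Arc (x y : Real.Angle) : y ∈ Arc x y := mem_Arc_iff.2 le_rfl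

lemma left_notMem_ArcInt (x y : Real.Angle) : x ∉ ArcInt x y := fun h => by
  simpa [arcLen_self] using (mem_ArcInt_iff.1 h).1

lemma right_notMem_ArcInt (x y : Real.Angle) : y ∉ ArcInt x y := fun h =>
  lt_irrefl _ (mem_ArcInt_iff.1 h).2

/-- Positions measured from `x` are positions measured from `c` shifted by the length of
`[x;c]`, as long as they do not wrap around. -/
lemma arcLen_of_add_lt {x c z : Real.Angle} (h : arcLen x c + arcLen c z < 2 * π) :
    arcLen x z = arcLen x c + arcLen c z := by
  have hz : z = x + ((arcLen x c + arcLen c z : ℝ) : Real.Angle) := by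
    rw [Real.Angle.coe_add, ← add_assoc, add_arcLen, add_arcLen]
  conv_lhs => rw [hz]
  exact arcLen_add (add_nonneg (arcLen_nonneg x c) (arcLen_nonneg c z)) h

lemma arcLen_of_le {x c z : Real.Angle} (h : arcLen x c ≤ arcLen x z) :
    arcLen c z = arcLen x z - arcLen x c := by
  have hz : z = c + ((arcLen x z - arcLen x c : ℝ) : Real.Angle) := by
    calc z = x + (arcLen x z : Real.Angle) := (add_arcLen x z).symm
      _ = x + (arcLen x c : Real.Angle) + ((arcLen x z - arcLen x c : ℝ) : Real.Angle) := by
        rw [add_assoc, ← Real.Angle.coe_add, add_sub_cancel]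
      _ = c + ((arcLen x z - arcLen x c : ℝ) : Real.Angle) := by rw [add_arcLen]
  conv_lhs => rw [hz]
  exact arcLen_add (sub_nonneg.2 h) (by linarith [arcLen_lt_two_pi x z, arcLen_nonneg x c])

lemma Arc_subset_of_mem_left {x y c : Real.Angle} (hc : c ∈ Arc x y) : Arc x c ⊆ Arc x y :=
  fun _ hz => mem_Arc_iff.2 ((mem_Arc_iff.1 hz).trans (mem_Arc_iff.1 hc))

lemma mem_Arc_right_iff {x y c z : Real.Angle} (hc : c ∈ Arc x y) :
    z ∈ Arc c y ↔ arcLen x c ≤ arcLen x z ∧ arcLen x z ≤ arcLen x y := by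
  rw [mem_Arc_iff] at hc
  rw [mem_Arc_iff, arcLen_of_le hc]
  constructor
  · intro h
    rw [arcLen_of_add_lt (c := c) (z := z) (by linarith [arcLen_lt_two_pi x y])]
    constructor <;> linarith [arcLen_nonneg c z]
  · rintro ⟨h1, h2⟩
    rw [arcLen_of_le h1]
    linarith

lemma Arc_subset_of_mem_right {x y c : Real.Angle} (hc : c ∈ Arc x y) : Arc c y ⊆ Arc x y :=
  fun _ hz => mem_Arc_iff.2 ((mem_Arc_right_iff hc).1 hz).2

lemma mem_Arc_of_mem_ArcInt {x y z : Real.Angle} (hz : z ∈ ArcInt x y) : z ∈ Arc x y := by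
  obtain ⟨t, h0, h1, h⟩ := hz
  exact ⟨t, h0.le, h1.le, h⟩

/-- `x₁, x₂` are `a, a'` in some order. -/
def IsPair (x₁ x₂ a a' : Real.Angle) : Prop := (x₁ = a ∧ x₂ = a') ∨ (x₁ = a' ∧ x₂ = a)

lemma exists_pos_forall_notMem_Ioc (F : Finset ℝ) {L : ℝ} (hL : 0 < L) :
    ∃ ε, 0 < ε ∧ ε < L ∧ ∀ r ∈ F, ¬ (0 < r ∧ r ≤ ε) := by
  induction F using Finset.induction_on with
  | empty => exact ⟨L / 2, by linarith, by linarith, by simp⟩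
  | insert r F _ ih =>
    obtain ⟨ε, h0, h1, h2⟩ := ih
    by_cases hr : 0 < r
    · refine ⟨min ε (r / 2), lt_min h0 (by linarith), (min_le_left _ _).trans_lt h1, ?_⟩
      intro s hs ⟨hs0, hs1⟩
      rcases Finset.mem_insert.1 hs with rfl | hs
      · linarith [hs1.trans (min_le_right _ _)]
      · exact h2 s hs ⟨hs0, hs1.trans (min_le_left _ _)⟩
    · refine ⟨ε, h0, h1, fun s hs hs' => ?_⟩
      rcases Finset.mem_insert.1 hs with rfl | hs
      · exact hr hs'.1
      · exact h2 s hs hs'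

/-- An arc with endpoints `a`, `a'` can be cut at a point `c` so close to `a` that no
point of the finite set `F` lies between `a` and `c`. -/
lemma exists_cut_near {t₁ t₂ a a' : Real.Angle} (F : Finset Real.Angle) (ht : t₁ ≠ t₂)
    (hp : IsPair t₁ t₂ a a') (ha : a ∈ F) (ha' : a' ∈ F) :
    ∃ c x₁ x₂ y₁ y₂, c ∉ F ∧ IsPair x₁ x₂ a c ∧ IsPair y₁ y₂ a' c ∧
      Arc x₁ x₂ ⊆ Arc t₁ t₂ ∧ Arc y₁ y₂ ⊆ Arc t₁ t₂ ∧ a ∉ Arc y₁ y₂ ∧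
      ∀ z ∈ F, z ∉ ArcInt x₁ x₂ := by
  have hL := arcLen_pos ht
  have hL' := arcLen_lt_two_pi t₁ t₂
  rcases hp with ⟨rfl, rfl⟩ | ⟨rfl, rfl⟩
  · obtain ⟨ε, h0, h1, h2⟩ := exists_pos_forall_notMem_Ioc (F.image (arcLen t₁)) hL
    have hε : arcLen t₁ (t₁ + (ε : Real.Angle)) = ε := arcLen_add h0.le (h1.trans hL')
    have hc : t₁ + (ε : Real.Angle) ∈ Arc t₁ t₂ := mem_Arc_iff.2 (by rw [hε]; exact h1.le)
    refine ⟨t₁ + (ε : Real.Angle), t₁, t₁ + (ε : Real.Angle), t₁ + (ε : Real.Angle), t₂, ?_,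
      Or.inl ⟨rfl, rfl⟩, Or.inr ⟨rfl, rfl⟩, Arc_subset_of_mem_left hc,
      Arc_subset_of_mem_right hc, ?_, ?_⟩
    · intro h
      exact h2 _ (Finset.mem_image_of_mem _ h) (by rw [hε]; exact ⟨h0, le_rfl⟩)
    · rw [mem_Arc_right_iff hc, hε, arcLen_self]
      exact fun h => absurd h.1 (not_le.2 h0)
    · intro z hz h
      rw [mem_ArcInt_iff, hε] at h
      exact h2 _ (Finset.mem_image_of_mem _ hz) ⟨h.1, h.2.le⟩
  · obtain ⟨ε, h0, h1, h2⟩ := exists_pos_forall_notMem_Ioc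
      (F.image fun z => arcLen t₁ t₂ - arcLen t₁ z) hL
    have hε : arcLen t₁ (t₁ + ((arcLen t₁ t₂ - ε : ℝ) : Real.Angle)) = arcLen t₁ t₂ - ε :=
      arcLen_add (by linarith) (by linarith)
    set c := t₁ + ((arcLen t₁ t₂ - ε : ℝ) : Real.Angle)
    have hc : c ∈ Arc t₁ t₂ := mem_Arc_iff.2 (by rw [hε]; linarith)
    refine ⟨c, c, t₂, t₁, c, ?_, Or.inr ⟨rfl, rfl⟩, Or.inl ⟨rfl, rfl⟩,
      Arc_subset_of_mem_right hc, Arc_subset_of_mem_left hc, ?_, ?_⟩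
    · intro h
      exact h2 _ (Finset.mem_image_of_mem _ h) (by constructor <;> linarith)
    · rw [mem_Arc_iff, hε]
      linarith
    · intro z hz h
      have hz' := (mem_Arc_right_iff hc).1 (mem_Arc_of_mem_ArcInt h)
      rw [mem_ArcInt_iff, arcLen_of_le hz'.1, arcLen_of_le (mem_Arc_iff.1 hc)] at h
      exact h2 _ (Finset.mem_image_of_mem _ hz) (by constructor <;> linarith)

/-! ### Relabelling the meridians and longitudes of a diagram -/

lemma MeridianOK.map {V : Finset Torus} {sgn : Torus → Bool} (h : MeridianOK V sgn)
    (f g : Equiv.Perm Real.Angle) :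
    MeridianOK (V.map (f.prodCongr g).toEmbedding) (sgn ∘ (f.prodCongr g).symm) := by
  intro θ
  rcases h (f.symm θ) with h | ⟨u, w, hu, hw, huw, hu1, hw1, hs, hx⟩
  · left
    intro v hv
    obtain ⟨v, hvV, rfl⟩ := Finset.mem_map.1 hv
    intro hv'
    exact h v hvV (by rw [← hv']; simp)
  · refine Or.inr ⟨f.prodCongr g u, f.prodCongr g w, Finset.mem_map_of_mem _ hu,
      Finset.mem_map_of_mem _ hw, (f.prodCongr g).injective.ne huw, by simp [hu1], by simp [hw1],
      by simpa only [Function.comp, Equiv.symm_apply_apply] using hs, ?_⟩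
    intro x hx' hx1
    obtain ⟨x, hxV, rfl⟩ := Finset.mem_map.1 hx'
    rcases hx x hxV (by rw [← hx1]; simp) with rfl | rfl <;> simp

lemma LongitudeOK.map {V : Finset Torus} {sgn : Torus → Bool} (h : LongitudeOK V sgn)
    (f g : Equiv.Perm Real.Angle) :
    LongitudeOK (V.map (f.prodCongr g).toEmbedding) (sgn ∘ (f.prodCongr g).symm) := by
  intro θ
  rcases h (g.symm θ) with h | ⟨u, w, hu, hw, huw, hu1, hw1, hs, hx⟩
  · left
    intro v hv
    obtain ⟨v, hvV, rfl⟩ := Finset.mem_map.1 hv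
    intro hv'
    exact h v hvV (by rw [← hv']; simp)
  · refine Or.inr ⟨f.prodCongr g u, f.prodCongr g w, Finset.mem_map_of_mem _ hu,
      Finset.mem_map_of_mem _ hw, (f.prodCongr g).injective.ne huw, by simp [hu1], by simp [hw1],
      by simpa only [Function.comp, Equiv.symm_apply_apply] using hs, ?_⟩
    intro x hx' hx1
    obtain ⟨x, hxV, rfl⟩ := Finset.mem_map.1 hx'
    rcases hx x hxV (by rw [← hx1]; simp) with rfl | rfl <;> simp

lemma IsDiagSet.map {V : Finset Torus} {sgn : Torus → Bool} (h : IsDiagSet V sgn)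
    (f g : Equiv.Perm Real.Angle) :
    IsDiagSet (V.map (f.prodCongr g).toEmbedding) (sgn ∘ (f.prodCongr g).symm) :=
  ⟨h.1.map f g, h.2.map f g⟩

lemma map_prodCongr_map_symm (f g : Equiv.Perm Real.Angle) (S : Finset Torus) :
    (S.map (f.prodCongr g).toEmbedding).map (f.symm.prodCongr g.symm).toEmbedding = S := by
  ext ⟨x, y⟩
  simp

lemma comp_prodCongr_comp_symm {α : Type*} (f g : Equiv.Perm Real.Angle) (s : Torus → α) :
    (s ∘ (f.prodCongr g).symm) ∘ (f.symm.prodCongr g.symm).symm = s := by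
  funext ⟨x, y⟩
  simp

lemma IsComponent.map {V S : Finset Torus} {sgn : Torus → Bool} (h : IsComponent V sgn S)
    (f g : Equiv.Perm Real.Angle) :
    IsComponent (V.map (f.prodCongr g).toEmbedding) (sgn ∘ (f.prodCongr g).symm)
      (S.map (f.prodCongr g).toEmbedding) := by
  obtain ⟨hSV, hne, hd, hmin⟩ := h
  refine ⟨Finset.map_subset_map.2 hSV, hne.map, hd.map f g, fun S' hS' hne' hd' => ?_⟩
  have key := hmin (S'.map (f.symm.prodCongr g.symm).toEmbedding) ?_ hne'.map ?_
  · rw [← key]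
    exact (map_prodCongr_map_symm f.symm g.symm S').symm
  · rw [← map_prodCongr_map_symm f g S]
    exact Finset.map_subset_map.2 hS'
  · have := hd'.map f.symm g.symm
    rwa [comp_prodCongr_comp_symm] at this

/-- The image of a diagram under a permutation of the meridians and a permutation of the
longitudes. -/
def RectDiagram.relabel (R : RectDiagram) (f g : Equiv.Perm Real.Angle) : RectDiagram where
  verts := R.verts.map (f.prodCongr g).toEmbedding
  sgn := R.sgn ∘ (f.prodCongr g).symm
  comp := R.comp ∘ (f.prodCongr g).symm
  diag := R.diag.map f g
  comp_eq_iff := by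
    intro u hu v hv
    obtain ⟨u, huR, rfl⟩ := Finset.mem_map.1 hu
    obtain ⟨v, hvR, rfl⟩ := Finset.mem_map.1 hv
    have h := R.comp_eq_iff u huR v hvR
    simp only [Function.comp, Equiv.coe_toEmbedding, Equiv.symm_apply_apply]
    rw [h]
    constructor
    · rintro ⟨S, hS, huS, hvS⟩
      exact ⟨_, hS.map f g, Finset.mem_map_of_mem _ huS, Finset.mem_map_of_mem _ hvS⟩
    · rintro ⟨S, hS, huS, hvS⟩
      refine ⟨S.map (f.symm.prodCongr g.symm).toEmbedding, ?_, ?_, ?_⟩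
      · have := hS.map f.symm g.symm
        rwa [comp_prodCongr_comp_symm, map_prodCongr_map_symm] at this
      · exact Finset.mem_map.2 ⟨_, huS, (f.prodCongr g).symm_apply_apply u⟩
      · exact Finset.mem_map.2 ⟨_, hvS, (f.prodCongr g).symm_apply_apply v⟩

lemma RectDiagram.mem_relabel {R : RectDiagram} {f g : Equiv.Perm Real.Angle} {v : Torus} :
    v ∈ (R.relabel f g).verts ↔ (f.symm v.1, g.symm v.2) ∈ R.verts := by
  constructor
  · intro h
    obtain ⟨u, hu, rfl⟩ := Finset.mem_map.1 h
    simpa using hu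
  · intro h
    exact Finset.mem_map.2 ⟨_, h, by simp⟩

lemma RectDiagram.card_relabel (R : RectDiagram) (f g : Equiv.Perm Real.Angle) :
    (R.relabel f g).verts.card = R.verts.card := Finset.card_map _

lemma RectDiagram.sgn_relabel (R : RectDiagram) (f g : Equiv.Perm Real.Angle) (v : Torus) :
    (R.relabel f g).sgn v = R.sgn (f.symm v.1, g.symm v.2) := rfl

lemma RectDiagram.comp_relabel (R : RectDiagram) (f g : Equiv.Perm Real.Angle) (v : Torus) :
    (R.relabel f g).comp v = R.comp (f.symm v.1, g.symm v.2) := rfl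

/-! ### Stabilizations -/

lemma mem_corners_iff {t₁ t₂ p₁ p₂ a a' b b' : Real.Angle} (ht : IsPair t₁ t₂ a a')
    (hp : IsPair p₁ p₂ b b') {v : Torus} :
    v ∈ corners t₁ t₂ p₁ p₂ ↔ v = (a, b) ∨ v = (a, b') ∨ v = (a', b) ∨ v = (a', b') := by
  rcases ht with ⟨rfl, rfl⟩ | ⟨rfl, rfl⟩ <;> rcases hp with ⟨rfl, rfl⟩ | ⟨rfl, rfl⟩ <;>
    simp only [corners, Finset.mem_insert, Finset.mem_singleton] <;> tauto

lemma corners_subset_RectSet {t₁ t₂ p₁ p₂ : Real.Angle} {v : Torus}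
    (hv : v ∈ corners t₁ t₂ p₁ p₂) : v ∈ RectSet t₁ t₂ p₁ p₂ := by
  simp only [corners, Finset.mem_insert, Finset.mem_singleton] at hv
  rcases hv with rfl | rfl | rfl | rfl <;>
    simp [RectSet, left_mem_Arc, right_mem_Arc]

lemma IsPair.ne {x₁ x₂ a a' : Real.Angle} (h : IsPair x₁ x₂ a a') (ha : a ≠ a') : x₁ ≠ x₂ := by
  rcases h with ⟨rfl, rfl⟩ | ⟨rfl, rfl⟩
  · exact ha
  · exact ha.symm

lemma IsPair.notMem_ArcInt {x₁ x₂ a a' : Real.Angle} (h : IsPair x₁ x₂ a a') :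
    a' ∉ ArcInt x₁ x₂ := by
  rcases h with ⟨rfl, rfl⟩ | ⟨rfl, rfl⟩
  · exact right_notMem_ArcInt _ _
  · exact left_notMem_ArcInt _ _

/-- A pair of diagrams whose vertices differ by the corners of an otherwise empty rectangle
is an elementary move. -/
lemma isElemMoveWith_of {R₁ R₂ : RectDiagram} {t₁ t₂ p₁ p₂ : Real.Angle} (ht : t₁ ≠ t₂)
    (hp : p₁ ≠ p₂)
    (hc : ∀ v, v ∈ corners t₁ t₂ p₁ p₂ ↔
      (v ∈ R₁.verts ∧ v ∉ R₂.verts) ∨ (v ∈ R₂.verts ∧ v ∉ R₁.verts))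
    (he : ∃ u v, u ∈ corners t₁ t₂ p₁ p₂ ∧ v ∈ corners t₁ t₂ p₁ p₂ ∧ IsEdge R₂ u v)
    (hn : ∃ v ∈ R₁.verts, v ∉ R₂.verts)
    (hr : ∀ v ∈ RectSet t₁ t₂ p₁ p₂, ¬ (v ∈ R₁.verts ∧ v ∈ R₂.verts))
    (hs : ∀ v, v ∈ R₁.verts → v ∈ R₂.verts → R₁.sgn v = R₂.sgn v ∧ R₁.comp v = R₂.comp v) :
    IsElemMoveWith R₁ R₂ t₁ t₂ p₁ p₂ := by
  have hsd : symmDiff R₁.verts R₂.verts = corners t₁ t₂ p₁ p₂ := by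
    ext v
    rw [hc, Finset.mem_symmDiff]
  refine ⟨ht, hp, hsd, ?_, ?_, ?_, ?_, ?_⟩
  · obtain ⟨u, v, hu, hv, h⟩ := he
    exact ⟨u, v, hsd ▸ hu, hsd ▸ hv, Or.inr h⟩
  · obtain ⟨v, hv, hv'⟩ := hn
    exact fun h => hv' (h hv)
  · obtain ⟨u, -, hu, -, huR, -⟩ := he
    rcases (hc u).1 hu with h | h
    · exact absurd huR h.2
    · exact fun h' => h.2 (h' huR)
  · ext v
    simp only [Set.mem_inter_iff, Set.mem_union, Finset.mem_coe]
    constructor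
    · rintro ⟨hv, h⟩
      have := hr v hv
      rw [hc]
      tauto
    · intro hv
      refine ⟨corners_subset_RectSet hv, ?_⟩
      rw [hc] at hv
      tauto
  · intro v hv
    rw [Finset.mem_inter] at hv
    exact hs v hv.1 hv.2

lemma IsStab.exists_corner {R₁ R₂ : RectDiagram} (h : IsStab R₁ R₂) :
    ∃ t₁ t₂ p₁ p₂ a a' b b', IsElemMoveWith R₁ R₂ t₁ t₂ p₁ p₂ ∧ IsPair t₁ t₂ a a' ∧
      IsPair p₁ p₂ b b' ∧ R₁.verts \ R₂.verts = {(a, b)} := by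
  obtain ⟨⟨t₁, t₂, p₁, p₂, hm⟩, hcard⟩ := h
  have ht := hm.1
  have hp := hm.2.1
  have hsd := hm.2.2.1
  have h4 : (corners t₁ t₂ p₁ p₂).card = 4 := by
    simp [corners, ht, hp]
  have h5 : (R₁.verts \ R₂.verts).card + (R₂.verts \ R₁.verts).card = 4 := by
    rw [← h4, ← hsd, symmDiff_def, Finset.sup_eq_union,
      Finset.card_union_of_disjoint disjoint_sdiff_sdiff]
  have h6 := Finset.card_sdiff_add_card R₁.verts R₂.verts
  have h7 := Finset.card_sdiff_add_card R₂.verts R₁.verts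
  rw [Finset.union_comm] at h7
  obtain ⟨v, hv⟩ := Finset.card_eq_one.1 (show (R₁.verts \ R₂.verts).card = 1 by omega)
  have hvc : v ∈ corners t₁ t₂ p₁ p₂ := by
    have : v ∈ R₁.verts \ R₂.verts := by simp [hv]
    rw [← hsd, Finset.mem_symmDiff]
    exact Or.inl (Finset.mem_sdiff.1 this)
  simp only [corners, Finset.mem_insert, Finset.mem_singleton] at hvc
  rcases hvc with rfl | rfl | rfl | rfl
  · exact ⟨_, _, _, _, _, _, _, _, hm, Or.inl ⟨rfl, rfl⟩, Or.inl ⟨rfl, rfl⟩, hv⟩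
  · exact ⟨_, _, _, _, _, _, _, _, hm, Or.inl ⟨rfl, rfl⟩, Or.inr ⟨rfl, rfl⟩, hv⟩
  · exact ⟨_, _, _, _, _, _, _, _, hm, Or.inr ⟨rfl, rfl⟩, Or.inl ⟨rfl, rfl⟩, hv⟩
  · exact ⟨_, _, _, _, _, _, _, _, hm, Or.inr ⟨rfl, rfl⟩, Or.inr ⟨rfl, rfl⟩, hv⟩

lemma MeridianOK.eq_or_eq {V : Finset Torus} {sgn : Torus → Bool} (h : MeridianOK V sgn)
    {u w x : Torus} (hu : u ∈ V) (hw : w ∈ V) (huw : u ≠ w) (h1 : u.1 = w.1) (hx : x ∈ V)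
    (hxu : x.1 = u.1) : x = u ∨ x = w := by
  rcases h u.1 with h | ⟨y, z, -, -, -, -, -, -, h⟩
  · exact absurd rfl (h u hu)
  · have := h u hu rfl
    have := h w hw h1.symm
    have := h x hx hxu
    grind

lemma LongitudeOK.eq_or_eq {V : Finset Torus} {sgn : Torus → Bool} (h : LongitudeOK V sgn)
    {u w x : Torus} (hu : u ∈ V) (hw : w ∈ V) (huw : u ≠ w) (h1 : u.2 = w.2) (hx : x ∈ V)
    (hxu : x.2 = u.2) : x = u ∨ x = w := by
  rcases h u.2 with h | ⟨y, z, -, -, -, -, -, -, h⟩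
  · exact absurd rfl (h u hu)
  · have := h u hu rfl
    have := h w hw h1.symm
    have := h x hx hxu
    grind

/-- Moving one meridian and one longitude of a diagram having three corners of a rectangle
`{a, a'} × {b, b'}` among its vertices. -/
lemma RectDiagram.relabel_swap_spec {R : RectDiagram} {P : Torus → Prop}
    {a a' b b' c d : Real.Angle}
    (hR : ∀ v, v ∈ R.verts ↔ P v ∨ v = (a, b') ∨ v = (a', b) ∨ v = (a', b'))
    (hP : ∀ v, P v → v.1 ≠ a' ∧ v.1 ≠ c ∧ v.2 ≠ b' ∧ v.2 ≠ d)
    (ha : a ≠ a') (hac : a ≠ c) (hb : b ≠ b') (hbd : b ≠ d) :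
    (∀ v, v ∈ (R.relabel (Equiv.swap a' c) (Equiv.swap b' d)).verts ↔
      P v ∨ v = (a, d) ∨ v = (c, b) ∨ v = (c, d)) ∧
    ∀ {α : Type} (s : Torus → α),
      (∀ v, P v → s (Equiv.swap a' c v.1, Equiv.swap b' d v.2) = s v) ∧
      s (Equiv.swap a' c a, Equiv.swap b' d d) = s (a, b') ∧
      s (Equiv.swap a' c c, Equiv.swap b' d b) = s (a', b) := by
  have hfix : ∀ v : Torus, P v → (Equiv.swap a' c v.1, Equiv.swap b' d v.2) = v := by
    intro v hv
    obtain ⟨h1, h2, h3, h4⟩ := hP v hv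
    rw [Equiv.swap_apply_of_ne_of_ne h1 h2, Equiv.swap_apply_of_ne_of_ne h3 h4]
  have hfa := Equiv.swap_apply_of_ne_of_ne ha hac
  have hfb := Equiv.swap_apply_of_ne_of_ne hb hbd
  refine ⟨fun v => ?_, fun s => ⟨fun v hv => by rw [hfix v hv], ?_, ?_⟩⟩
  · rw [RectDiagram.mem_relabel, Equiv.symm_swap, Equiv.symm_swap, hR]
    have hinv : ∀ p q : Real.Angle, (Equiv.swap a' c v.1, Equiv.swap b' d v.2) = (p, q) ↔
        v = (Equiv.swap a' c p, Equiv.swap b' d q) := by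
      intro p q
      rw [Prod.ext_iff, Prod.ext_iff, Equiv.swap_apply_eq_iff, Equiv.swap_apply_eq_iff]
    rw [hinv, hinv, hinv, hfa, hfb, Equiv.swap_apply_left, Equiv.swap_apply_left]
    refine or_congr_left ⟨fun h => ?_, fun h => ?_⟩
    · have := hfix _ h
      rw [Equiv.swap_apply_self, Equiv.swap_apply_self] at this
      rw [show v = _ from this]
      exact h
    · rwa [hfix v h]
  · rw [hfa, Equiv.swap_apply_right]
  · rw [hfb, Equiv.swap_apply_right]

/-- Every stabilization of rectangular diagrams decomposes into a chain of three
elementary moves in which the first move is a local stabilization and the other two are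
exchange moves. -/
theorem stab_eq_local_stab_then_exchanges (R₁ R₂ : RectDiagram) (h : IsStab R₁ R₂) :
    ∃ S T : RectDiagram, IsLocalStab R₁ S ∧ IsExchange S T ∧ IsExchange T R₂ := by
  obtain ⟨t₁, t₂, p₁, p₂, a, a', b, b', hm, hpt, hpp, hdiff⟩ := h.exists_corner
  obtain ⟨ht, hp, hsd, -, -, -, hrect, hagree⟩ := hm
  have hcard := h.2
  have ha : a ≠ a' := by rcases hpt with ⟨rfl, rfl⟩ | ⟨rfl, rfl⟩; exacts [ht, ht.symm]
  have hb : b ≠ b' := by rcases hpp with ⟨rfl, rfl⟩ | ⟨rfl, rfl⟩; exacts [hp, hp.symm]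
  -- the vertices of the two diagrams
  have hd1 : ∀ v, v ∈ R₁.verts ∧ v ∉ R₂.verts ↔ v = (a, b) := fun v => by
    rw [← Finset.mem_sdiff, hdiff, Finset.mem_singleton]
  have hd : ∀ v, ((v ∈ R₁.verts ∧ v ∉ R₂.verts) ∨ (v ∈ R₂.verts ∧ v ∉ R₁.verts)) ↔
      v = (a, b) ∨ v = (a, b') ∨ v = (a', b) ∨ v = (a', b') := fun v => by
    rw [← mem_corners_iff hpt hpp, ← hsd, Finset.mem_symmDiff]
  have hd2 : ∀ v, v ∈ R₂.verts ∧ v ∉ R₁.verts ↔ v = (a, b') ∨ v = (a', b) ∨ v = (a', b') := by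
    intro v
    have h1 := hd1 v
    have h2 := hd v
    have h3 : v = (a, b) → ¬ (v = (a, b') ∨ v = (a', b) ∨ v = (a', b')) := by
      rintro rfl
      simp [ha, hb]
    tauto
  set P : Torus → Prop := fun v => v ∈ R₁.verts ∧ v ∈ R₂.verts with hPdef
  have hR₁ : ∀ v, v ∈ R₁.verts ↔ P v ∨ v = (a, b) := fun v => by
    rw [← hd1 v, hPdef]; tauto
  have hR₂ : ∀ v, v ∈ R₂.verts ↔ P v ∨ v = (a, b') ∨ v = (a', b) ∨ v = (a', b') := fun v => by
    rw [← hd2 v, hPdef]; tauto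
  have hPa : ∀ v, P v → v.1 ≠ a' := fun v hv hva => by
    have := R₂.diag.1.eq_or_eq (u := (a', b)) (w := (a', b')) ((hR₂ _).2 (by simp))
      ((hR₂ _).2 (by simp)) (by simp [hb]) rfl hv.2 hva
    exact ((hd2 v).2 (Or.inr this)).2 hv.1
  have hPb : ∀ v, P v → v.2 ≠ b' := fun v hv hvb => by
    have := R₂.diag.2.eq_or_eq (u := (a, b')) (w := (a', b')) ((hR₂ _).2 (by simp))
      ((hR₂ _).2 (by simp)) (by simp [ha]) rfl hv.2 hvb
    exact ((hd2 v).2 (by tauto)).2 hv.1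
  have hPrect : ∀ v, P v → v ∉ RectSet t₁ t₂ p₁ p₂ := fun v hv hvr => by
    have h1 : v ∈ RectSet t₁ t₂ p₁ p₂ ∩ ((R₁.verts : Set Torus) ∪ R₂.verts) :=
      ⟨hvr, Or.inl hv.1⟩
    rw [hrect, Finset.mem_coe, ← hsd, Finset.mem_symmDiff] at h1
    rcases h1 with h1 | h1
    exacts [h1.2 hv.2, h1.2 hv.1]
  -- the auxiliary meridian and longitude
  have hfst : ∀ v ∈ R₁.verts ∪ R₂.verts, v.1 ∈ (R₁.verts ∪ R₂.verts).image Prod.fst :=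
    fun v hv => Finset.mem_image_of_mem _ hv
  have hsnd : ∀ v ∈ R₁.verts ∪ R₂.verts, v.2 ∈ (R₁.verts ∪ R₂.verts).image Prod.snd :=
    fun v hv => Finset.mem_image_of_mem _ hv
  have hvab : (a, b) ∈ R₁.verts ∪ R₂.verts := Finset.mem_union_left _ ((hR₁ _).2 (Or.inr rfl))
  have hvab' : (a', b') ∈ R₁.verts ∪ R₂.verts :=
    Finset.mem_union_right _ ((hR₂ _).2 (by simp))
  obtain ⟨c, x₁, x₂, y₁, y₂, hcF, hx, hy, hxs, hys, hay, hxF⟩ :=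
    exists_cut_near _ ht hpt (hfst _ hvab) (hfst _ hvab')
  obtain ⟨d, z₁, z₂, w₁, w₂, hdF, hz, hw, hzs, hws, hbw, hzF⟩ :=
    exists_cut_near _ hp hpp (hsnd _ hvab) (hsnd _ hvab')
  have hac : a ≠ c := fun e => hcF (e ▸ hfst _ hvab)
  have ha'c : a' ≠ c := fun e => hcF (e ▸ hfst _ hvab')
  have hbd : b ≠ d := fun e => hdF (e ▸ hsnd _ hvab)
  have hb'd : b' ≠ d := fun e => hdF (e ▸ hsnd _ hvab')
  have hPU : ∀ v, P v → v ∈ R₁.verts ∪ R₂.verts := fun v hv => Finset.mem_union_left _ hv.1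
  have hPc : ∀ v, P v → v.1 ≠ c := fun v hv e => hcF (e ▸ hfst _ (hPU v hv))
  have hPd : ∀ v, P v → v.2 ≠ d := fun v hv e => hdF (e ▸ hsnd _ (hPU v hv))
  -- the intermediate diagrams
  obtain ⟨hS, hSval⟩ := RectDiagram.relabel_swap_spec hR₂
    (fun v hv => ⟨hPa v hv, hPc v hv, hPb v hv, hPd v hv⟩) ha hac hb hbd
  obtain ⟨hT, hTval⟩ := RectDiagram.relabel_swap_spec hR₂
    (fun v hv => ⟨hPa v hv, hPa v hv, hPb v hv, hPd v hv⟩) ha ha hb hbd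
  have hScard := R₂.card_relabel (Equiv.swap a' c) (Equiv.swap b' d)
  have hTcard := R₂.card_relabel (Equiv.swap a' a') (Equiv.swap b' d)
  have hSsgn := R₂.sgn_relabel (Equiv.swap a' c) (Equiv.swap b' d)
  have hTsgn := R₂.sgn_relabel (Equiv.swap a' a') (Equiv.swap b' d)
  have hScomp := R₂.comp_relabel (Equiv.swap a' c) (Equiv.swap b' d)
  have hTcomp := R₂.comp_relabel (Equiv.swap a' a') (Equiv.swap b' d)
  simp only [Equiv.symm_swap] at hSsgn hTsgn hScomp hTcomp
  set S := R₂.relabel (Equiv.swap a' c) (Equiv.swap b' d)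
  set T := R₂.relabel (Equiv.swap a' a') (Equiv.swap b' d)
  obtain ⟨hSs, hSs1, -⟩ := hSval R₂.sgn
  obtain ⟨hSc, hSc1, -⟩ := hSval R₂.comp
  obtain ⟨hTs, hTs1, hTs2⟩ := hTval R₂.sgn
  obtain ⟨hTc, hTc1, hTc2⟩ := hTval R₂.comp
  have hnP : ¬ P (a, b) ∧ (∀ q, ¬ P (a', q)) ∧ (∀ q, ¬ P (c, q)) ∧
      (∀ q, ¬ P (q, b')) ∧ ∀ q, ¬ P (q, d) :=
    ⟨fun h => ((hd1 _).2 rfl).2 h.2, fun q h => hPa _ h rfl, fun q h => hPc _ h rfl,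
      fun q h => hPb _ h rfl, fun q h => hPd _ h rfl⟩
  obtain ⟨hnab, hna', hnc, hnb', hnd⟩ := hnP
  have hcs : ∀ {u₁ u₂ v₁ v₂ : Real.Angle}, Arc u₁ u₂ ⊆ Arc t₁ t₂ → Arc v₁ v₂ ⊆ Arc p₁ p₂ →
      ∀ v, P v → v ∉ RectSet u₁ u₂ v₁ v₂ :=
    fun h1 h2 v hv hvr => hPrect v hv ⟨h1 hvr.1, h2 hvr.2⟩
  refine ⟨S, T, ⟨x₁, x₂, z₁, z₂, ⟨isElemMoveWith_of (hx.ne hac) (hz.ne hbd) ?_ ?_ ?_ ?_ ?_, ?_⟩,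
      by omega⟩,
    ⟨⟨y₁, y₂, z₁, z₂, isElemMoveWith_of (hy.ne ha'c) (hz.ne hbd) ?_ ?_ ?_ ?_ ?_⟩, by omega⟩,
    ⟨⟨t₁, t₂, w₁, w₂, isElemMoveWith_of ht (hw.ne hb'd) ?_ ?_ ?_ ?_ ?_⟩, by omega⟩⟩
  -- the local stabilization
  · intro v
    rw [mem_corners_iff hx hz, hR₁, hS]
    constructor
    · rintro (rfl | rfl | rfl | rfl) <;>
        simp [hnab, hnc, hnd, hac, hac.symm, hbd, hbd.symm]
    · generalize P v = Q
      clear * -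
      tauto
  · refine ⟨(c, b), (c, d), ?_, ?_, (hS _).2 (by simp), (hS _).2 (by simp), by simp [hbd],
      Or.inl rfl⟩ <;> rw [mem_corners_iff hx hz] <;> simp
  · exact ⟨(a, b), (hR₁ _).2 (Or.inr rfl), by rw [hS]; simp [hnab, hac, hbd]⟩
  · rintro v hv ⟨h1, h2⟩
    rw [hR₁] at h1
    rcases h1 with h1 | rfl
    · exact hcs hxs hzs v h1 hv
    · rw [hS] at h2
      simp [hnab, hac, hbd] at h2
  · intro v h1 h2
    rw [hR₁] at h1
    rcases h1 with h1 | rfl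
    · rw [hSsgn, hScomp, hSs v h1, hSc v h1]
      exact hagree v (Finset.mem_inter.2 h1)
    · rw [hS] at h2
      simp [hnab, hac, hbd] at h2
  · have key : ∀ v ∈ R₁.verts ∪ R₂.verts, v.1 ∉ ArcInt x₁ x₂ ∧ v.2 ∉ ArcInt z₁ z₂ :=
      fun v hv => ⟨hxF _ (hfst v hv), hzF _ (hsnd v hv)⟩
    rintro v (hv | hv)
    · exact key v (Finset.mem_union_left _ hv)
    · rw [hS] at hv
      rcases hv with hv | rfl | rfl | rfl
      · exact key v (hPU v hv)
      · exact ⟨(key _ hvab).1, hz.notMem_ArcInt⟩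
      · exact ⟨hx.notMem_ArcInt, (key _ hvab).2⟩
      · exact ⟨hx.notMem_ArcInt, hz.notMem_ArcInt⟩
  -- the exchange of the two meridians
  · intro v
    rw [mem_corners_iff hy hz, hS, hT]
    constructor
    · rintro (rfl | rfl | rfl | rfl) <;>
        simp [hna', hnc, hac.symm, ha.symm, ha'c, ha'c.symm]
    · generalize P v = Q
      clear * -
      tauto
  · refine ⟨(a', b), (a', d), ?_, ?_, (hT _).2 (by simp), (hT _).2 (by simp), by simp [hbd],
      Or.inl rfl⟩ <;> rw [mem_corners_iff hy hz] <;> simp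
  · exact ⟨(c, b), (hS _).2 (by simp), by rw [hT]; simp [hnc, hac.symm, ha'c.symm]⟩
  · rintro v hv ⟨h1, h2⟩
    rw [hS] at h1
    rw [hT] at h2
    rcases h1 with h1 | rfl | rfl | rfl
    · exact hcs hys hzs v h1 hv
    · exact hay hv.1
    · simp [hnc, hac.symm, ha'c.symm] at h2
    · simp [hnc, hac.symm, ha'c.symm] at h2
  · intro v h1 h2
    rw [hS] at h1
    rw [hT] at h2
    rw [hSsgn, hScomp, hTsgn, hTcomp]
    rcases h1 with h1 | rfl | rfl | rfl
    · rw [hSs v h1, hSc v h1, hTs v h1, hTc v h1]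
      exact ⟨rfl, rfl⟩
    · rw [hSs1, hSc1, hTs1, hTc1]
      exact ⟨rfl, rfl⟩
    · simp [hnc, hac.symm, ha'c.symm] at h2
    · simp [hnc, hac.symm, ha'c.symm] at h2
  -- the exchange of the two longitudes
  · intro v
    rw [mem_corners_iff hpt hw, hT, hR₂]
    constructor
    · rintro (rfl | rfl | rfl | rfl) <;>
        simp [hnb', hnd, hb.symm, hbd.symm, hb'd, hb'd.symm]
    · generalize P v = Q
      clear * -
      tauto
  · refine ⟨(a, b'), (a', b'), ?_, ?_, (hR₂ _).2 (by simp), (hR₂ _).2 (by simp), by simp [ha],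
      Or.inr rfl⟩ <;> rw [mem_corners_iff hpt hw] <;> simp
  · exact ⟨(a, d), (hT _).2 (by simp), by rw [hR₂]; simp [hnd, hbd.symm, hb'd.symm]⟩
  · rintro v hv ⟨h1, h2⟩
    rw [hT] at h1
    rw [hR₂] at h2
    rcases h1 with h1 | rfl | rfl | rfl
    · exact hcs subset_rfl hws v h1 hv
    · simp [hnd, hbd.symm, hb'd.symm] at h2
    · exact hbw hv.2
    · simp [hnd, hbd.symm, hb'd.symm] at h2
  · intro v h1 h2
    rw [hT] at h1
    rw [hR₂] at h2
    rw [hTsgn, hTcomp]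
    rcases h1 with h1 | rfl | rfl | rfl
    · rw [hTs v h1, hTc v h1]
      exact ⟨rfl, rfl⟩
    · simp [hnd, hbd.symm, hb'd.symm] at h2
    · rw [hTs2, hTc2]
      exact ⟨rfl, rfl⟩
    · simp [hnd, hbd.symm, hb'd.symm] at h2

end RectDiag
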